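/- Let T > 0 and let d : (0,T) → (0,∞) be such that t ↦ d_t² is continuously differentiable on (0,T). For z ∈ ℂ \ ℝ and t ∈ (0,T) define G_t(z) = ∫_{−2}^{2} p_sc(x)/(z − d_t x) dx, where p_sc(x) = √(4 − x²)/(2π). Then for all t ∈ (0,T) and z ∈ ℂ \ ℝ, the partial derivatives ∂_t G_t(z) and ∂_z G_t(z) exist and satisfy ∂_t G_t(z) = −(d_t²)′ G_t(z) ∂_z G_t(z). -/

import Mathlib

open MeasureTheory intervalIntegral

/-- The Stieltjes transform of the semicircle law scaled by `a`:
`G(z) = ∫_{−2}^{2} p_sc(x)/(z − a x) dx` where `p_sc(x) = √(4 − x²)/(2π)`. -/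
noncomputable def semicircleStieltjes (a : ℝ) (z : ℂ) : ℂ :=
  ∫ x in (-2:ℝ)..2, ((Real.sqrt (4 - x ^ 2) / (2 * Real.pi) : ℝ) : ℂ) / (z - (a : ℂ) * (x : ℂ))

theorem Complex.exists_add_inv_eq_of_im_ne_zero {w : ℂ} (hw : w.im ≠ 0) :
    ∃ u : ℂ, u ≠ 0 ∧ ‖u‖ < 1 ∧ w = u + u⁻¹ := by
  have key : ∃ u : ℂ, u ≠ 0 ∧ w = u + u⁻¹ := by
    obtain ⟨c, hc⟩ := Complex.cos_surjective (w / 2)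
    refine ⟨Complex.exp (c * Complex.I), Complex.exp_ne_zero _, ?_⟩
    rw [← Complex.exp_neg, ← neg_mul, ← Complex.two_cos, hc]
    ring
  obtain ⟨u, hu, rfl⟩ := key
  rcases lt_trichotomy ‖u‖ 1 with h | h | h
  · exact ⟨u, hu, h, rfl⟩
  · refine absurd ?_ hw
    rw [Complex.inv_eq_conj h]
    simp
  · exact ⟨u⁻¹, inv_ne_zero hu, by rw [norm_inv]; exact inv_lt_one_of_one_lt₀ h, by
      rw [inv_inv, add_comm]⟩

theorem Complex.sub_ofReal_ne_zero {w : ℂ} (hw : w.im ≠ 0) (x : ℝ) : w - x ≠ 0 := by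
  intro h
  apply hw
  simpa using congrArg Complex.im h

theorem Complex.exp_add_inv_exp_ofReal_mul_I (θ : ℝ) :
    Complex.exp (θ * Complex.I) + (Complex.exp (θ * Complex.I))⁻¹ =
      ((2 * Real.cos θ : ℝ) : ℂ) := by
  rw [← Complex.exp_neg, ← neg_mul, ← Complex.two_cos]
  push_cast
  rfl

/-- Evaluation by the Cauchy integral formula on the unit circle. -/
theorem integral_one_sub_exp_sq_div {u w : ℂ} (hu : u ≠ 0) (hu1 : ‖u‖ < 1) (hw : w = u + u⁻¹)
    (him : w.im ≠ 0) :
    ∫ θ in (0:ℝ)..2 * Real.pi, (1 - Complex.exp (θ * Complex.I) ^ 2) /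
      (w - ((2 * Real.cos θ : ℝ) : ℂ)) = 2 * Real.pi * u := by
  have hne : ∀ ζ : ℂ, ‖ζ‖ ≤ 1 → u * ζ - 1 ≠ 0 := by
    intro ζ hζ h
    have h1 : u * ζ = 1 := by linear_combination h
    have h2 := congrArg norm h1
    rw [norm_mul, norm_one] at h2
    nlinarith [norm_nonneg u, norm_nonneg ζ]
  have hd : DifferentiableOn ℂ (fun ζ : ℂ => -(1 - ζ ^ 2) * u / (u * ζ - 1) / Complex.I)
      (Metric.closedBall 0 1) := by
    intro ζ hζ
    have := hne ζ (by simpa using hζ)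
    apply DifferentiableAt.differentiableWithinAt
    fun_prop (disch := assumption)
  have hC := (hd.diffContOnCl_ball (c := (0:ℂ)) (R := 1) subset_rfl).circleIntegral_sub_inv_smul
    (w := u) (by simpa using hu1)
  have hval : (2 * Real.pi * Complex.I : ℂ) • (-(1 - u ^ 2) * u / (u * u - 1) / Complex.I)
      = 2 * Real.pi * u := by
    have := hne u hu1.le
    have hI := Complex.I_ne_zero
    rw [show -(1 - u ^ 2) * u / (u * u - 1) = u by rw [div_eq_iff this]; ring, smul_eq_mul]
    field_simp
  rw [← hval, ← hC, circleIntegral]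
  refine integral_congr fun θ _ => ?_
  have hζ := Complex.exp_ne_zero (θ * Complex.I)
  have h1 := hne (Complex.exp (θ * Complex.I)) (Complex.norm_exp_ofReal_mul_I θ).le
  have h3 := Complex.sub_ofReal_ne_zero him (2 * Real.cos θ)
  have h2 : Complex.exp (θ * Complex.I) - u ≠ 0 := by
    intro h
    have := Complex.norm_exp_ofReal_mul_I θ
    rw [sub_eq_zero.mp h] at this
    exact hu1.ne this
  simp only [deriv_circleMap, circleMap_zero, Complex.ofReal_one, one_mul, smul_eq_mul]
  rw [← Complex.exp_add_inv_exp_ofReal_mul_I] at h3 ⊢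
  generalize Complex.exp (θ * Complex.I) = ζ at *
  have h4 : w - (ζ + ζ⁻¹) = (ζ - u) * (u * ζ - 1) / (-(u * ζ)) := by
    rw [hw]; field_simp; ring
  rw [h4]
  have hI := Complex.I_ne_zero
  field_simp

theorem semicircleStieltjes_one_eq_integral_sin {w : ℂ} (hw : w.im ≠ 0) :
    semicircleStieltjes 1 w = (2 * Real.pi : ℂ)⁻¹ * ∫ θ in (0:ℝ)..Real.pi,
      ((4 * Real.sin θ ^ 2 : ℝ) : ℂ) / (w - ((2 * Real.cos θ : ℝ) : ℂ)) := by
  have hsub := integral_deriv_smul_comp (a := Real.pi) (b := 0) (f := fun θ => 2 * Real.cos θ)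
    (f' := fun θ => 2 * (-Real.sin θ))
    (g := fun x : ℝ => ((Real.sqrt (4 - x ^ 2) / (2 * Real.pi) : ℝ) : ℂ) /
      (w - ((1 : ℝ) : ℂ) * (x : ℂ)))
    (fun θ _ => (Real.hasDerivAt_cos θ).const_mul 2) (by fun_prop)
    (by
      refine Continuous.div (by fun_prop) (by fun_prop) fun x => ?_
      simpa using Complex.sub_ofReal_ne_zero hw x)
  simp only [Real.cos_pi, Real.cos_zero, mul_neg, mul_one] at hsub
  rw [semicircleStieltjes, ← hsub, integral_symm, ← intervalIntegral.integral_neg,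
    ← intervalIntegral.integral_const_mul]
  refine integral_congr fun θ hθ => ?_
  rw [Set.uIcc_of_le Real.pi_pos.le] at hθ
  have hs := Real.sin_nonneg_of_mem_Icc hθ
  have hsqrt : Real.sqrt (4 - (2 * Real.cos θ) ^ 2) = 2 * Real.sin θ := by
    rw [show 4 - (2 * Real.cos θ) ^ 2 = (2 * Real.sin θ) ^ 2 by
      linear_combination 4 * (Real.sin_sq_add_cos_sq θ).symm]
    exact Real.sqrt_sq (by positivity)
  have hpi : (Real.pi : ℂ) ≠ 0 := by exact_mod_cast Real.pi_ne_zero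
  have h3 := Complex.sub_ofReal_ne_zero hw (2 * Real.cos θ)
  simp only [Function.comp, hsqrt, Complex.real_smul]
  push_cast at h3 ⊢
  field_simp
  ring

theorem semicircleStieltjes_one_eq {u w : ℂ} (hu : u ≠ 0) (hu1 : ‖u‖ < 1) (hw : w = u + u⁻¹)
    (him : w.im ≠ 0) : semicircleStieltjes 1 w = u := by
  have hpi : (Real.pi : ℂ) ≠ 0 := by exact_mod_cast Real.pi_ne_zero
  have hcont : Continuous fun θ : ℝ => (1 - Complex.exp (θ * Complex.I) ^ 2) /
      (w - ((2 * Real.cos θ : ℝ) : ℂ)) :=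
    Continuous.div (by fun_prop) (by fun_prop) fun θ => Complex.sub_ofReal_ne_zero him _
  have hF := integral_one_sub_exp_sq_div hu hu1 hw him
  rw [← integral_add_adjacent_intervals (hcont.intervalIntegrable 0 Real.pi)
    (hcont.intervalIntegrable _ _)] at hF
  have hrefl := integral_comp_sub_left (a := 0) (b := Real.pi)
    (fun θ : ℝ => (1 - Complex.exp (θ * Complex.I) ^ 2) /
      (w - ((2 * Real.cos θ : ℝ) : ℂ))) (2 * Real.pi)
  rw [sub_zero, show 2 * Real.pi - Real.pi = Real.pi by ring] at hrefl
  rw [← hrefl, ← integral_add (hcont.intervalIntegrable _ _)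
    ((hcont.comp' (continuous_sub_left (2 * Real.pi))).intervalIntegrable _ _)] at hF
  rw [semicircleStieltjes_one_eq_integral_sin him, inv_mul_eq_iff_eq_mul₀ (by simp [hpi]), ← hF]
  refine integral_congr fun θ _ => ?_
  have hexp : Complex.exp (((2 * Real.pi - θ : ℝ) : ℂ) * Complex.I)
      = (Complex.exp (θ * Complex.I))⁻¹ := by
    rw [← Complex.exp_neg]
    push_cast
    rw [sub_mul, Complex.exp_sub, Complex.exp_two_pi_mul_I, Complex.exp_neg, one_div]
  have hsin : ((4 * Real.sin θ ^ 2 : ℝ) : ℂ) = 4 - ((2 * Real.cos θ : ℝ) : ℂ) ^ 2 := by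
    rw [Real.sin_sq]; push_cast; ring
  have hζ := Complex.exp_ne_zero (θ * Complex.I)
  simp only [hexp, Real.cos_two_pi_sub]
  rw [← add_div, hsin, ← Complex.exp_add_inv_exp_ofReal_mul_I]
  congr 1
  field_simp
  ring

/-- The self-consistent equation `m² = w m − 1` for the semicircle law. -/
theorem semicircleStieltjes_one_sq {w : ℂ} (hw : w.im ≠ 0) :
    semicircleStieltjes 1 w ^ 2 = w * semicircleStieltjes 1 w - 1 := by
  obtain ⟨u, hu, hu1, h⟩ := Complex.exists_add_inv_eq_of_im_ne_zero hw
  rw [semicircleStieltjes_one_eq hu hu1 h hw, h]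
  field_simp
  ring

theorem differentiableAt_semicircleStieltjes_one {w : ℂ} (hw : w.im ≠ 0) :
    DifferentiableAt ℂ (semicircleStieltjes 1) w := by
  set p : ℝ → ℝ := fun x => Real.sqrt (4 - x ^ 2) / (2 * Real.pi) with hp
  have hpc : Continuous p := by fun_prop
  have hp0 : ∀ x, 0 ≤ p x := fun x => by positivity
  set r := |w.im| / 2 with hr
  have hr0 : 0 < r := by positivity
  have hlow : ∀ v ∈ Metric.ball w r, r ≤ |v.im| := by
    intro v hv
    have h1 : |(w - v).im| < r :=
      (Complex.abs_im_le_norm _).trans_lt (by rwa [← dist_eq_norm, dist_comm])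
    have h2 : |w.im| - |v.im| ≤ |(w - v).im| := by
      rw [Complex.sub_im]; exact abs_sub_abs_le_abs_sub _ _
    linarith
  have hne : ∀ v ∈ Metric.ball w r, ∀ x : ℝ, v - x ≠ 0 := fun v hv x =>
    Complex.sub_ofReal_ne_zero (abs_pos.mp (hr0.trans_le (hlow v hv))) x
  have hw' := Metric.mem_ball_self (x := w) hr0
  have hFc : ∀ v ∈ Metric.ball w r, Continuous fun x : ℝ => (p x : ℂ) / (v - x) := fun v hv =>
    Continuous.div (by fun_prop) (by fun_prop) (hne v hv)
  have hF'c : Continuous fun x : ℝ => -(p x : ℂ) / (w - x) ^ 2 :=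
    Continuous.div (by fun_prop) (by fun_prop) fun x => pow_ne_zero 2 (hne w hw' x)
  have h := hasDerivAt_integral_of_dominated_loc_of_deriv_le (μ := volume) (a := -2) (b := 2)
    (F := fun (v : ℂ) (x : ℝ) => (p x : ℂ) / (v - x))
    (F' := fun (v : ℂ) (x : ℝ) => -(p x : ℂ) / (v - x) ^ 2) (bound := fun x => p x / r ^ 2)
    (Metric.ball_mem_nhds w hr0)
    (Filter.eventually_of_mem (Metric.ball_mem_nhds w hr0) fun v hv =>
      (hFc v hv).aestronglyMeasurable)
    ((hFc w hw').intervalIntegrable _ _) hF'c.aestronglyMeasurable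
    (Filter.Eventually.of_forall fun x _ v hv => by
      rw [norm_div, norm_neg, norm_pow, Complex.norm_real, Real.norm_of_nonneg (hp0 x)]
      have h1 : r ≤ ‖v - x‖ := (hlow v hv).trans (by simpa using Complex.abs_im_le_norm (v - x))
      have := hp0 x
      gcongr)
    ((hpc.div_const _).intervalIntegrable _ _)
    (Filter.Eventually.of_forall fun x _ v hv => by
      convert! (hasDerivAt_const v (p x : ℂ)).div ((hasDerivAt_id v).sub_const (x : ℂ))
        (hne v hv x) using 1
      simp)
  refine h.2.differentiableAt.congr_of_eventuallyEq (Filter.Eventually.of_forall fun v => ?_)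
  simp [semicircleStieltjes, hp]

theorem semicircleStieltjes_eq_inv_mul {a : ℝ} (ha : a ≠ 0) (z : ℂ) :
    semicircleStieltjes a z = (a : ℂ)⁻¹ * semicircleStieltjes 1 (z / a) := by
  have ha' : (a : ℂ) ≠ 0 := by exact_mod_cast ha
  rw [semicircleStieltjes, semicircleStieltjes, ← intervalIntegral.integral_const_mul]
  congr 1
  ext x
  rw [show z - a * x = a * (z / a - ((1 : ℝ) : ℂ) * x) by push_cast; field_simp,
    mul_comm (a : ℂ), ← div_div, div_eq_inv_mul]

/-- The derivative of the self-consistent equation. -/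
theorem two_mul_semicircleStieltjes_one_mul_deriv {w : ℂ} (hw : w.im ≠ 0) :
    2 * semicircleStieltjes 1 w * deriv (semicircleStieltjes 1) w
      = semicircleStieltjes 1 w + w * deriv (semicircleStieltjes 1) w := by
  have hm := (differentiableAt_semicircleStieltjes_one hw).hasDerivAt
  have hev : (fun v => semicircleStieltjes 1 v ^ 2)
      =ᶠ[nhds w] fun v => v * semicircleStieltjes 1 v - 1 := by
    filter_upwards [Complex.continuous_im.continuousAt.eventually_ne hw] with v hv
    exact semicircleStieltjes_one_sq hv
  have h := (hm.fun_pow 2).unique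
    ((((hasDerivAt_id w).fun_mul hm).sub_const 1).congr_of_eventuallyEq hev)
  simpa using h

/-- **PDE for the Stieltjes transform of the scaled semicircle law** (Remark 3.1 /
eq. (3.9)): if `t ↦ d_t²` is continuously differentiable on `(0,T)` with `d_t > 0`, and
`G_t(z) = ∫ p_sc(x)/(z − d_t x) dx`, then for `t ∈ (0,T)` and `z ∈ ℂ \ ℝ` the partial
derivatives `∂_t G_t(z)` and `∂_z G_t(z)` exist and
`∂_t G_t(z) = −(d_t²)′ G_t(z) ∂_z G_t(z)`. -/
theorem semicircleStieltjes_pde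
    (T : ℝ) (hT : 0 < T) (d : ℝ → ℝ)
    (hdpos : ∀ t ∈ Set.Ioo (0:ℝ) T, 0 < d t)
    (hd2 : ContDiffOn ℝ 1 (fun t => d t ^ 2) (Set.Ioo (0:ℝ) T)) :
    ∀ t ∈ Set.Ioo (0:ℝ) T, ∀ z : ℂ, z.im ≠ 0 →
      ∃ gt gz : ℂ,
        HasDerivAt (fun s => semicircleStieltjes (d s) z) gt t ∧
        HasDerivAt (fun w => semicircleStieltjes (d t) w) gz z ∧
        gt = -((deriv (fun s => d s ^ 2) t : ℝ) : ℂ) * semicircleStieltjes (d t) z * gz := by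
  intro t ht z hz
  have hd0 := hdpos t ht
  have hdt' : (d t : ℂ) ≠ 0 := by exact_mod_cast hd0.ne'
  have hnhds := isOpen_Ioo.mem_nhds ht
  have hsq : HasDerivAt (fun s => d s ^ 2) (deriv (fun s => d s ^ 2) t) t :=
    ((hd2.differentiableOn one_ne_zero).differentiableAt hnhds).hasDerivAt
  have hd : HasDerivAt d (deriv (fun s => d s ^ 2) t / (2 * d t)) t := by
    have h := hsq.sqrt (pow_pos hd0 2).ne'
    rw [Real.sqrt_sq hd0.le] at h
    refine h.congr_of_eventuallyEq ?_
    filter_upwards [hnhds] with s hs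
    exact (Real.sqrt_sq (hdpos s hs).le).symm
  set D := deriv (fun s => d s ^ 2) t
  have him : (z / d t).im ≠ 0 := by
    rw [Complex.div_ofReal_im]
    exact div_ne_zero hz hd0.ne'
  have hm := (differentiableAt_semicircleStieltjes_one him).hasDerivAt
  have hode := two_mul_semicircleStieltjes_one_mul_deriv him
  have hdinv := hd.ofReal_comp.fun_inv hdt'
  have hdiv : HasDerivAt (fun s => z / (d s : ℂ))
      (z * (-((D / (2 * d t) : ℝ) : ℂ) / (d t : ℂ) ^ 2)) t := by
    simp only [div_eq_mul_inv z]
    exact hdinv.const_mul z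
  have ht' := (hdinv.fun_mul (hm.scomp t hdiv)).congr_of_eventuallyEq
    (f₁ := fun s => semicircleStieltjes (d s) z) (by
      filter_upwards [hnhds] with s hs
      exact semicircleStieltjes_eq_inv_mul (hdpos s hs).ne' z)
  have hz' := ((HasDerivAt.comp (h₂ := semicircleStieltjes 1) z hm
    ((hasDerivAt_id z).div_const (d t : ℂ))).const_mul
    (d t : ℂ)⁻¹).congr_of_eventuallyEq (f₁ := fun w => semicircleStieltjes (d t) w)
      (Filter.Eventually.of_forall fun w => semicircleStieltjes_eq_inv_mul hd0.ne' w)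
  refine ⟨_, _, ht', hz', ?_⟩
  rw [semicircleStieltjes_eq_inv_mul hd0.ne' z]
  simp only [Function.comp, smul_eq_mul]
  generalize semicircleStieltjes 1 (z / d t) = m at *
  generalize deriv (semicircleStieltjes 1) (z / d t) = m' at *
  push_cast
  field_simp at hode ⊢
  linear_combination D * hode
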